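/- For every real ε > 0 there exists N such that for every n ≥ N, every 2-CNF formula φ with at most n variables has a 2-CNF encoding φ' (over base variables Var(φ) and possibly additional auxiliary variables) with |φ'| ≤ (log₂(3)/4 + ε) · n² / log₂ n. -/

import Mathlib

namespace BVAPaper

/-- A literal is a propositional variable (a natural number) together with a
polarity: `true` for a positive literal, `false` for a negative one. -/
abbrev Lit := ℕ × Bool

/-- A clause is a finite set of literals (required to be pairwise
non-complementary via `IsClause`). -/
abbrev Clause := Finset Lit

/-- A formula is a finite set of clauses; its size is its number of clauses. -/
abbrev Formula := Finset Clause

/-- A genuine clause: it contains no pair of complementary literals. -/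
def IsClause (C : Clause) : Prop := ∀ v : ℕ, ¬ ((v, true) ∈ C ∧ (v, false) ∈ C)

/-- A 2-CNF formula: every member is a genuine clause with exactly two literals. -/
def Is2CNF (φ : Formula) : Prop := ∀ C ∈ φ, IsClause C ∧ C.card = 2

/-- The set of variables occurring in a formula. -/
def Vars (φ : Formula) : Finset ℕ := φ.biUnion (fun C => C.image Prod.fst)

/-- A literal is true under an assignment. -/
def LitTrue (τ : ℕ → Bool) (l : Lit) : Prop := τ l.1 = l.2

/-- An assignment satisfies a formula if it makes some literal of every clause true. -/
def Satisfies (τ : ℕ → Bool) (φ : Formula) : Prop := ∀ C ∈ φ, ∃ l ∈ C, LitTrue τ l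

/-- `φ` semantically implies the equivalence of the literals `l₁` and `l₂`. -/
def ImpliesEquiv (φ : Formula) (l₁ l₂ : Lit) : Prop :=
  ∀ τ : ℕ → Bool, Satisfies τ φ → (LitTrue τ l₁ ↔ LitTrue τ l₂)

/-- A simple 2-CNF formula: (a) no two distinct literals are implied equivalent,
(b) every clause contains a negative literal, (c) no two distinct clauses are over
the same pair of variables. -/
def IsSimple (φ : Formula) : Prop :=
  (∀ l₁ l₂ : Lit, l₁ ≠ l₂ → ¬ ImpliesEquiv φ l₁ l₂) ∧
  (∀ C ∈ φ, ∃ l ∈ C, l.2 = false) ∧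
  (∀ C₁ ∈ φ, ∀ C₂ ∈ φ, C₁.image Prod.fst = C₂.image Prod.fst → C₁ = C₂)

/-- A monotone formula: every literal occurring in it is positive. -/
def MonotoneFormula (φ : Formula) : Prop := ∀ C ∈ φ, ∀ l ∈ C, l.2 = true

/-- `𝒞 ⋈ 𝒟`: the set of clauses `C ∪ D` for `C ∈ 𝒞` and `D ∈ 𝒟`. -/
def JoinClauses (𝒞 𝒟 : Finset Clause) : Finset Clause :=
  (𝒞 ×ˢ 𝒟).image (fun p => p.1 ∪ p.2)

/-- One BVA step. -/
def BVAStep (φ φ' : Formula) : Prop :=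
  ∃ (𝒞 𝒟 : Finset Clause) (y : ℕ),
    (∀ C ∈ 𝒞, IsClause C ∧ C.Nonempty) ∧
    (∀ D ∈ 𝒟, IsClause D ∧ D.Nonempty) ∧
    JoinClauses 𝒞 𝒟 ⊆ φ ∧
    y ∉ Vars φ ∧
    φ' = (φ \ JoinClauses 𝒞 𝒟)
      ∪ 𝒞.image (fun C => insert ((y, true) : Lit) C)
      ∪ 𝒟.image (fun D => insert ((y, false) : Lit) D)

/-- Idealized BVA: the reflexive transitive closure of single BVA steps. -/
def BVAChain : Formula → Formula → Prop := Relation.ReflTransGen BVAStep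

/-- Negate the variables from `S` inside a literal. -/
def flipLit (S : Finset ℕ) (l : Lit) : Lit := if l.1 ∈ S then (l.1, !l.2) else l

/-- Negate the variables from `S` throughout a formula. -/
def flipFormula (S : Finset ℕ) (φ : Formula) : Formula :=
  φ.image (fun C => C.image (flipLit S))

/-- `φ ≅_W φ'`: `φ'` is obtained from `φ` by replacing some variables from `W`
by their negations wherever they appear. -/
def EquivW (W : Finset ℕ) (φ φ' : Formula) : Prop :=
  ∃ S ⊆ W, φ' = flipFormula S φ

/-- `φ'` encodes `φ` over the base variables `X`: for every assignment `τ` of `X`,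
`τ` satisfies `φ` iff `τ` extends to a satisfying assignment of `φ'`. -/
def Encodes (φ' φ : Formula) (X : Finset ℕ) : Prop :=
  ∀ τ : ℕ → Bool,
    Satisfies τ φ ↔ ∃ σ : ℕ → Bool, (∀ x ∈ X, σ x = τ x) ∧ Satisfies σ φ'

/-- The direct encoding of the at-most-one constraint on the variables `0, …, n-1`. -/
def atMostOne (n : ℕ) : Formula :=
  (((Finset.range n) ×ˢ (Finset.range n)).filter (fun p => p.1 < p.2)).image
    (fun p => ({(p.1, false), (p.2, false)} : Clause))

/-- A diagram: a graph with both undirected edges (represented as a symmetric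
set of ordered pairs) and directed edges. -/
structure Diagram where
  verts : Finset ℕ
  undir : Finset (ℕ × ℕ)
  dir : Finset (ℕ × ℕ)

/-- Well-formedness of a diagram: no loops, edges between vertices, the
undirected edge set is symmetric, and at most one edge between any two vertices. -/
def Diagram.WF (G : Diagram) : Prop :=
  (∀ e ∈ G.undir, e.1 ∈ G.verts ∧ e.2 ∈ G.verts ∧ e.1 ≠ e.2) ∧
  (∀ e ∈ G.dir, e.1 ∈ G.verts ∧ e.2 ∈ G.verts ∧ e.1 ≠ e.2) ∧
  (∀ u v : ℕ, (u, v) ∈ G.undir → (v, u) ∈ G.undir) ∧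
  (∀ u v : ℕ, (u, v) ∈ G.undir → (u, v) ∉ G.dir ∧ (v, u) ∉ G.dir) ∧
  (∀ u v : ℕ, (u, v) ∈ G.dir → (v, u) ∉ G.dir)

/-- The complete diagram `K_n` on vertices `0, …, n-1`: all edges undirected. -/
def completeDiagram (n : ℕ) : Diagram where
  verts := Finset.range n
  undir := ((Finset.range n) ×ˢ (Finset.range n)).filter (fun p => p.1 ≠ p.2)
  dir := ∅

/-- The diagram associated to a simple 2-CNF formula: an undirected edge
`{x, y}` for each clause `(¬x ∨ ¬y)` and a directed edge `(x, y)` for each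
clause `(¬x ∨ y)`. -/
def diagramOf (φ : Formula) : Diagram where
  verts := Vars φ
  undir := ((Vars φ) ×ˢ (Vars φ)).filter
    (fun p => ({(p.1, false), (p.2, false)} : Clause) ∈ φ)
  dir := ((Vars φ) ×ˢ (Vars φ)).filter
    (fun p => ({(p.1, false), (p.2, true)} : Clause) ∈ φ)

/-- A polarized diagram: a directed graph with a polarity on its edges
(`true` = `+`, `false` = `−`). -/
structure PolDiagram where
  verts : Finset ℕ
  edges : Finset (ℕ × ℕ)
  pol : ℕ × ℕ → Bool

/-- `(P, P.pol)` is a polarized diagram of the diagram `G`: every undirected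
edge of `G` is oriented (in exactly one way) with polarity `−`, and every
directed edge of `G` is kept with polarity `+`. -/
def IsPolarizationOf (P : PolDiagram) (G : Diagram) : Prop :=
  P.verts = G.verts ∧
  (∀ u v : ℕ, (u, v) ∈ G.dir ↔ ((u, v) ∈ P.edges ∧ P.pol (u, v) = true)) ∧
  (∀ u v : ℕ, (u, v) ∈ G.undir ↔
    (((u, v) ∈ P.edges ∧ P.pol (u, v) = false) ∨
     ((v, u) ∈ P.edges ∧ P.pol (v, u) = false))) ∧
  (∀ u v : ℕ, ¬ ((u, v) ∈ P.edges ∧ (v, u) ∈ P.edges))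

/-- A polarized rectifier network: base vertices, auxiliary vertices, directed
edges, and a polarity function (only meaningful on edges into base vertices). -/
structure PRN where
  base : Finset ℕ
  aux : Finset ℕ
  edges : Finset (ℕ × ℕ)
  pol : ℕ × ℕ → Bool

/-- Well-formedness of a PRN: base and auxiliary vertices are disjoint, and
edges are loopless edges between vertices. -/
def PRN.WF (R : PRN) : Prop :=
  Disjoint R.base R.aux ∧
  (∀ e ∈ R.edges, e.1 ∈ R.base ∪ R.aux ∧ e.2 ∈ R.base ∪ R.aux ∧ e.1 ≠ e.2)

/-- A valid walk from the base vertex `u` to the base vertex `v`: a sequence of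
length ≥ 2 of consecutive edges whose interior vertices are auxiliary. -/
def ValidWalk (R : PRN) (u v : ℕ) (π : List ℕ) : Prop :=
  2 ≤ π.length ∧
  π.head? = some u ∧ π.getLast? = some v ∧
  u ∈ R.base ∧ v ∈ R.base ∧
  List.Chain' (fun a b => (a, b) ∈ R.edges) π ∧
  (∀ i : ℕ, 0 < i → i + 1 < π.length → π.getD i 0 ∈ R.aux)

/-- The polarity of a walk: the polarity of its last edge. -/
def walkPol (R : PRN) (π : List ℕ) : Bool :=
  R.pol (π.getD (π.length - 2) 0, π.getD (π.length - 1) 0)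

/-- A strict polarized rectifier network: (1) for distinct base vertices `u, v`
there is at most one valid walk from `u` to `v` or from `v` to `u` in total, and
(2) every auxiliary vertex belongs to some valid walk. -/
def IsSPRN (R : PRN) : Prop :=
  (∀ u ∈ R.base, ∀ v ∈ R.base, u ≠ v →
    ∀ π₁ π₂ : List ℕ,
      (ValidWalk R u v π₁ ∨ ValidWalk R v u π₁) →
      (ValidWalk R u v π₂ ∨ ValidWalk R v u π₂) → π₁ = π₂) ∧
  (∀ a ∈ R.aux, ∃ u v : ℕ, ∃ π : List ℕ, ValidWalk R u v π ∧ a ∈ π)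

/-- The PRN `R` realizes the polarized diagram `P`. -/
def RealizesPol (R : PRN) (P : PolDiagram) : Prop :=
  R.base = P.verts ∧
  ∀ u ∈ P.verts, ∀ v ∈ P.verts,
    ((u, v) ∈ P.edges ↔ ∃ π : List ℕ, ValidWalk R u v π ∧ walkPol R π = P.pol (u, v))

/-- The PRN `R` realizes the diagram `G`: it realizes some polarized diagram of `G`. -/
def RealizesDiagram (R : PRN) (G : Diagram) : Prop :=
  ∃ P : PolDiagram, IsPolarizationOf P G ∧ RealizesPol R P

/-- The 2-CNF formula `F_R` associated to a PRN `R`. -/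
def PRN.formula (R : PRN) : Formula :=
  R.edges.image (fun e =>
    if e.2 ∈ R.base ∧ R.pol e = false
    then ({(e.1, false), (e.2, false)} : Clause)
    else ({(e.1, false), (e.2, true)} : Clause))

/-- The PRN associated to a polarized diagram (no auxiliary vertices). -/
def prnOfPol (P : PolDiagram) : PRN :=
  ⟨P.verts, ∅, P.edges, P.pol⟩

/-- A coherent biclique `(X, Y)` of a PRN. -/
def CoherentBiclique (R : PRN) (X Y : Finset ℕ) : Prop :=
  X.Nonempty ∧ Y.Nonempty ∧ Disjoint X Y ∧
  X ⊆ R.base ∪ R.aux ∧ Y ⊆ R.base ∪ R.aux ∧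
  (∀ x ∈ X, ∀ y ∈ Y, (x, y) ∈ R.edges) ∧
  (∀ y ∈ Y, y ∈ R.base → ∀ x₁ ∈ X, ∀ x₂ ∈ X, R.pol (x₁, y) = R.pol (x₂, y))

/-- `R'` is the biclique reduction of `R` with respect to some coherent biclique. -/
def BicliqueStep (R R' : PRN) : Prop :=
  ∃ (X Y : Finset ℕ) (z : ℕ),
    CoherentBiclique R X Y ∧
    z ∉ R.base ∪ R.aux ∧
    R'.base = R.base ∧
    R'.aux = insert z R.aux ∧
    R'.edges = (R.edges \ (X ×ˢ Y)) ∪ (X ×ˢ ({z} : Finset ℕ)) ∪ (({z} : Finset ℕ) ×ˢ Y) ∧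
    (∀ y ∈ Y, y ∈ R.base → ∀ x ∈ X, R'.pol (z, y) = R.pol (x, y)) ∧
    (∀ e ∈ R.edges \ (X ×ˢ Y), e.2 ∈ R.base → R'.pol e = R.pol e)

/-- `R ↪* R'`: the reflexive transitive closure of biclique reduction. -/
def BicliqueChain : PRN → PRN → Prop := Relation.ReflTransGen BicliqueStep

/-- The total degree (in-degree plus out-degree) of a vertex in a PRN. -/
def totalDeg (R : PRN) (v : ℕ) : ℕ :=
  (R.edges.filter (fun e => e.1 = v)).card + (R.edges.filter (fun e => e.2 = v)).card

/-- The complementary literal. -/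
def negLit (l : Lit) : Lit := (l.1, !l.2)

/-- The clauses expressing the implications between literals listed in `E`. -/
def implFormula (E : Finset (Lit × Lit)) : Formula :=
  E.image (fun e => ({negLit e.1, e.2} : Clause))

lemma litTrue_negLit (τ : ℕ → Bool) (l : Lit) : LitTrue τ (negLit l) ↔ ¬ LitTrue τ l := by
  simp only [LitTrue, negLit]
  cases τ l.1 <;> cases l.2 <;> simp

lemma litTrue_congr {σ τ : ℕ → Bool} {l : Lit} (h : σ l.1 = τ l.1) :
    LitTrue σ l ↔ LitTrue τ l := by
  simp [LitTrue, h]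

lemma satisfies_implFormula (τ : ℕ → Bool) (E : Finset (Lit × Lit)) :
    Satisfies τ (implFormula E) ↔ ∀ e ∈ E, LitTrue τ e.1 → LitTrue τ e.2 := by
  simp only [Satisfies, implFormula, Finset.forall_mem_image, Finset.mem_insert,
    Finset.mem_singleton, exists_eq_or_imp, exists_eq_left, litTrue_negLit, ← imp_iff_not_or]

lemma is2CNF_implFormula (E : Finset (Lit × Lit)) (hE : ∀ e ∈ E, e.1.1 ≠ e.2.1) :
    Is2CNF (implFormula E) := by
  intro C hC
  obtain ⟨e, he, rfl⟩ := Finset.mem_image.1 hC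
  have h := hE e he
  refine ⟨?_, Finset.card_pair fun h' => h (by rw [← h']; rfl)⟩
  rintro v ⟨h1, h2⟩
  simp only [Finset.mem_insert, Finset.mem_singleton, negLit, Prod.ext_iff] at h1 h2
  grind

lemma card_implFormula_le (E : Finset (Lit × Lit)) : (implFormula E).card ≤ E.card :=
  Finset.card_image_le

/-- Every finite set is covered by few unordered pairs of its elements. -/
lemma exists_pairing (R : Finset ℕ) :
    ∃ P : Finset (ℕ × ℕ), P ⊆ R ×ˢ R ∧ 2 * P.card ≤ R.card + 1 ∧
      ∀ x ∈ R, ∃ p ∈ P, x = p.1 ∨ x = p.2 := by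
  induction R using Finset.strongInduction with
  | H R ih =>
    rcases R.eq_empty_or_nonempty with rfl | ⟨a, ha⟩
    · exact ⟨∅, by simp⟩
    rcases (R.erase a).eq_empty_or_nonempty with h | ⟨b, hb⟩
    · refine ⟨{(a, a)}, by simpa using ha, ?_, ?_⟩
      · have := Finset.card_pos.2 ⟨a, ha⟩
        rw [Finset.card_singleton]; omega
      · intro x hx
        refine ⟨(a, a), by simp, Or.inl ?_⟩
        by_contra hxa
        have : x ∈ R.erase a := Finset.mem_erase.2 ⟨hxa, hx⟩
        simp [h] at this
    · have hsub : (R.erase a).erase b ⊆ R :=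
        (Finset.erase_subset _ _).trans (Finset.erase_subset _ _)
      have hlt : (R.erase a).erase b ⊂ R :=
        (Finset.erase_subset _ _).trans_ssubset (Finset.erase_ssubset ha)
      obtain ⟨P, hP, hc, hcov⟩ := ih _ hlt
      have hbR : b ∈ R := Finset.mem_of_mem_erase hb
      refine ⟨insert (a, b) P, ?_, ?_, ?_⟩
      · refine Finset.insert_subset (Finset.mk_mem_product ha hbR) (hP.trans ?_)
        exact Finset.product_subset_product hsub hsub
      · have h1 := Finset.card_erase_add_one ha
        have h2 := Finset.card_erase_add_one hb
        have h3 := Finset.card_insert_le (a, b) P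
        omega
      · intro x hx
        by_cases hxa : x = a
        · exact ⟨(a, b), by simp, Or.inl hxa⟩
        by_cases hxb : x = b
        · exact ⟨(a, b), by simp, Or.inr hxb⟩
        obtain ⟨p, hp, h⟩ := hcov x (by simp [hxa, hxb, hx])
        exact ⟨p, Finset.mem_insert_of_mem hp, h⟩

lemma exists_fresh (α : Type*) [Countable α] (X : Finset ℕ) :
    ∃ g : α → ℕ, Function.Injective g ∧ ∀ a, g a ∉ X := by
  obtain ⟨f, hf⟩ := exists_injective_nat α
  refine ⟨fun a => X.sup id + 1 + f a, fun a b h => hf (by simpa using h), fun a h => ?_⟩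
  have : X.sup id + 1 + f a ≤ X.sup id := Finset.le_sup (f := id) h
  omega

lemma card_modEq_pairs_le (m G : ℕ) :
    ((Finset.range m ×ˢ Finset.range m).filter (fun p => p.1 % G = p.2 % G)).card
      ≤ m * (m / G + 1) := by
  calc _ ≤ (Finset.range m ×ˢ Finset.range (m / G + 1)).card := by
        refine Finset.card_le_card_of_injOn (fun p => (p.1, p.2 / G)) ?_ ?_
        · intro p hp
          simp only [Finset.coe_filter, Finset.mem_product, Finset.mem_range,
            Set.mem_ofPred_eq] at hp
          simp only [Finset.coe_product, Set.mem_prod, Finset.mem_coe, Finset.mem_range]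
          exact ⟨hp.1.1, Nat.lt_succ_of_le (Nat.div_le_div_right hp.1.2.le)⟩
        · intro p hp p' hp' h
          simp only [Finset.coe_filter, Set.mem_ofPred_eq] at hp hp'
          simp only [Prod.mk.injEq] at h
          refine Prod.ext h.1 ?_
          rw [← Nat.div_add_mod p.2 G, ← Nat.div_add_mod p'.2 G, h.2, ← hp.2, ← hp'.2, h.1]
    _ = _ := by simp

/-- The pattern of row `x` of the matrix `M` on the `j`-th block of `t` consecutive columns. -/
def blockPattern (M : ℕ → ℕ → Fin 3) (t j x : ℕ) : Fin t → Fin 3 := fun c => M x (j * t + c)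

/-- The rows below `m` can be paired up, block by block and pattern by pattern, using few pairs,
all of which consist of rows congruent modulo `G`. -/
lemma exists_block_pairing (m t G : ℕ) (hG : 0 < G) (M : ℕ → ℕ → Fin 3)
    (hM : ∀ i j, M i j ≠ 0 → i < j ∧ j < m) (q : ℕ) :
    ∃ Q : Finset ((ℕ × ℕ) × (ℕ × (Fin t → Fin 3))),
      (∀ e ∈ Q, (e.1.1 < m ∧ e.1.2 < m ∧ e.1.1 % G = e.1.2 % G) ∧
        blockPattern M t e.2.1 e.1.1 = e.2.2 ∧ blockPattern M t e.2.1 e.1.2 = e.2.2) ∧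
      (∀ j < q, ∀ x, blockPattern M t j x ≠ 0 →
        ∃ p, (p, (j, blockPattern M t j x)) ∈ Q ∧ (x = p.1 ∨ x = p.2)) ∧
      4 * Q.card ≤ t * (q * (q + 1)) + 2 * (q * (G * 3 ^ t)) := by
  classical
  choose P hP hPc hPcov using exists_pairing
  let S : ℕ → Finset ℕ := fun j => (Finset.range m).filter (fun x => blockPattern M t j x ≠ 0)
  let f : ℕ → ℕ → ℕ × (Fin t → Fin 3) := fun j x => (x % G, blockPattern M t j x)
  let K : Finset (ℕ × (Fin t → Fin 3)) := Finset.range G ×ˢ Finset.univ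
  let R : ℕ → ℕ × (Fin t → Fin 3) → Finset ℕ := fun j k => (S j).filter (fun x => f j x = k)
  have hlt : ∀ j x, blockPattern M t j x ≠ 0 → x < m ∧ x < (j + 1) * t := by
    intro j x h
    obtain ⟨c, hc⟩ := Function.ne_iff.1 h
    have := hM x (j * t + c) hc
    have := c.2
    constructor
    · omega
    · rw [add_mul]; omega
  have hScard : ∀ j, (S j).card ≤ (j + 1) * t := by
    intro j
    calc (S j).card ≤ (Finset.range ((j + 1) * t)).card := by
          refine Finset.card_le_card fun x hx => ?_
          exact Finset.mem_range.2 (hlt j x (Finset.mem_filter.1 hx).2).2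
      _ = _ := by simp
  have hRsum : ∀ j, ∑ k ∈ K, (R j k).card = (S j).card := by
    intro j
    refine (Finset.card_eq_sum_card_fiberwise fun x _ => ?_).symm
    simp [K, f, Nat.mod_lt _ hG]
  have hK : K.card = G * 3 ^ t := by simp [K]
  refine ⟨(Finset.range q).biUnion fun j => K.biUnion fun k =>
    (P (R j k)).image fun p => (p, (j, k.2)), ?_, ?_, ?_⟩
  · intro e he
    simp only [Finset.mem_biUnion, Finset.mem_image] at he
    obtain ⟨j, -, k, -, p, hp, rfl⟩ := he
    have := Finset.mem_product.1 (hP _ hp)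
    simp only [R, S, f, Finset.mem_filter, Finset.mem_range] at this
    grind
  · intro j hj x hx
    have hxR : x ∈ R j (f j x) := by
      simp only [R, S, Finset.mem_filter, Finset.mem_range, and_true]
      exact ⟨(hlt j x hx).1, hx⟩
    obtain ⟨p, hp, h⟩ := hPcov _ x hxR
    refine ⟨p, ?_, h⟩
    simp only [Finset.mem_biUnion, Finset.mem_image]
    exact ⟨j, Finset.mem_range.2 hj, f j x, by simp [K, f, Nat.mod_lt _ hG], p, hp, rfl⟩
  · have h1 : ∀ j, 2 * (K.biUnion fun k => (P (R j k)).image fun p => (p, (j, k.2))).card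
        ≤ (j + 1) * t + G * 3 ^ t := by
      intro j
      calc _ ≤ 2 * ∑ k ∈ K, (P (R j k)).card := by
            gcongr
            exact Finset.card_biUnion_le.trans
              (Finset.sum_le_sum fun k _ => Finset.card_image_le)
        _ = ∑ k ∈ K, 2 * (P (R j k)).card := Finset.mul_sum ..
        _ ≤ ∑ k ∈ K, ((R j k).card + 1) := Finset.sum_le_sum fun k _ => hPc _
        _ = (S j).card + G * 3 ^ t := by
            rw [Finset.sum_add_distrib, hRsum, Finset.sum_const, hK]; simp
        _ ≤ _ := by gcongr; exact hScard j
    have h2 : (∑ j ∈ Finset.range q, (j + 1)) * 2 = q * (q + 1) := by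
      have := Finset.sum_range_id_mul_two (q + 1)
      rw [Finset.sum_range_succ'] at this
      simpa [mul_comm] using this
    calc _ ≤ 4 * ∑ j ∈ Finset.range q,
          (K.biUnion fun k => (P (R j k)).image fun p => (p, (j, k.2))).card := by
          gcongr
          exact Finset.card_biUnion_le
      _ = 2 * ∑ j ∈ Finset.range q,
          2 * (K.biUnion fun k => (P (R j k)).image fun p => (p, (j, k.2))).card := by
          rw [← Finset.mul_sum]; ring
      _ ≤ 2 * ∑ j ∈ Finset.range q, ((j + 1) * t + G * 3 ^ t) := by
          gcongr with j _
          exact h1 j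
      _ = ((∑ j ∈ Finset.range q, (j + 1)) * 2) * t + 2 * (q * (G * 3 ^ t)) := by
          rw [Finset.sum_add_distrib, ← Finset.sum_mul, Finset.sum_const]
          simp; ring
      _ = _ := by rw [h2]; ring

/-- A literal or its complement, as prescribed by a matrix entry. -/
def entryLit (a : Fin 3) (l : Lit) : Lit := if a = 1 then l else negLit l

lemma entryLit_fst (a : Fin 3) (l : Lit) : (entryLit a l).1 = l.1 := by
  unfold entryLit; split <;> rfl

/-- Implications prescribed by a strictly upper triangular ternary matrix `M`, together with
the implications in `E₀`, have a short encoding. -/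
lemma exists_matrix_encoding (m t G : ℕ) (ht : 0 < t) (hG : 0 < G) (M : ℕ → ℕ → Fin 3)
    (hM : ∀ i j, M i j ≠ 0 → i < j ∧ j < m) (X : Finset ℕ) (L : ℕ → Lit)
    (hL : ∀ i < m, (L i).1 ∈ X) (E₀ : Finset (Lit × Lit))
    (hE₀ : ∀ e ∈ E₀, e.1.1 ∈ X ∧ e.2.1 ∈ X ∧ e.1.1 ≠ e.2.1) :
    ∃ φ' : Formula, Is2CNF φ' ∧
      (∀ τ : ℕ → Bool, (∃ σ : ℕ → Bool, (∀ x ∈ X, σ x = τ x) ∧ Satisfies σ φ') ↔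
        (∀ e ∈ E₀, LitTrue τ e.1 → LitTrue τ e.2) ∧
        ∀ i j, M i j ≠ 0 → LitTrue τ (L i) → LitTrue τ (entryLit (M i j) (L j))) ∧
      4 * φ'.card ≤ 4 * E₀.card + 8 * (m * (m / G + 1)) +
        (t * ((m / t + 1) * (m / t + 1 + 1)) + 2 * ((m / t + 1) * (G * 3 ^ t))) +
        4 * ((m / t + 1) * 3 ^ t * t) := by
  classical
  obtain ⟨Q, hQ, hQcov, hQcard⟩ := exists_block_pairing m t G hG M hM (m / t + 1)
  obtain ⟨g, hg, hgX⟩ := exists_fresh ((ℕ × ℕ) ⊕ (ℕ × (Fin t → Fin 3))) X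
  set pairs := (Finset.range m ×ˢ Finset.range m).filter (fun p => p.1 % G = p.2 % G) with hpairs
  set cells := ((Finset.range (m / t + 1) ×ˢ (Finset.univ : Finset (Fin t → Fin 3))) ×ˢ
    (Finset.univ : Finset (Fin t))).filter
      (fun c => c.1.1 * t + c.2 < m ∧ c.1.2 c.2 ≠ 0) with hcells
  let Z : ℕ × ℕ → Lit := fun p => (g (Sum.inl p), true)
  let W : ℕ × (Fin t → Fin 3) → Lit := fun w => (g (Sum.inr w), true)
  let E₁ : Finset (Lit × Lit) :=
    pairs.image (fun p => (L p.1, Z p)) ∪ pairs.image (fun p => (L p.2, Z p))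
  let E₂ : Finset (Lit × Lit) := Q.image (fun e => (Z e.1, W e.2))
  let E₃ : Finset (Lit × Lit) :=
    cells.image (fun c => (W c.1, entryLit (c.1.2 c.2) (L (c.1.1 * t + c.2))))
  have hsat : ∀ σ, Satisfies σ (implFormula (E₀ ∪ E₁ ∪ E₂ ∪ E₃)) ↔
      (∀ e ∈ E₀, LitTrue σ e.1 → LitTrue σ e.2) ∧
      (∀ p ∈ pairs, (LitTrue σ (L p.1) → LitTrue σ (Z p)) ∧
        (LitTrue σ (L p.2) → LitTrue σ (Z p))) ∧
      (∀ e ∈ Q, LitTrue σ (Z e.1) → LitTrue σ (W e.2)) ∧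
      (∀ c ∈ cells, LitTrue σ (W c.1) →
        LitTrue σ (entryLit (c.1.2 c.2) (L (c.1.1 * t + c.2)))) := by
    intro σ
    simp only [satisfies_implFormula, Finset.forall_mem_union, E₁, E₂, E₃,
      Finset.forall_mem_image, and_assoc, forall_and]
  refine ⟨implFormula (E₀ ∪ E₁ ∪ E₂ ∪ E₃), ?_, ?_, ?_⟩
  · refine is2CNF_implFormula _ ?_
    have hne : ∀ i < m, ∀ a, (L i).1 ≠ g a := fun i hi a h => hgX a (h ▸ hL i hi)
    simp only [Finset.forall_mem_union, E₁, E₂, E₃, Finset.forall_mem_image]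
    refine ⟨⟨⟨fun e he => (hE₀ e he).2.2, fun p hp => ?_, fun p hp => ?_⟩, fun e _ => ?_⟩,
      fun c hc => ?_⟩
    · simp only [hpairs, Finset.mem_filter, Finset.mem_product, Finset.mem_range] at hp
      exact hne _ hp.1.1 _
    · simp only [hpairs, Finset.mem_filter, Finset.mem_product, Finset.mem_range] at hp
      exact hne _ hp.1.2 _
    · exact fun h => by simpa using hg h
    · simp only [hcells, Finset.mem_filter] at hc
      rw [entryLit_fst]
      exact (hne _ hc.2.1 _).symm
  · intro τ
    simp only [hsat]
    constructor
    · rintro ⟨σ, hστ, h0, h1, h2, h3⟩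
      refine ⟨fun e he => ?_, fun i j hij hi => ?_⟩
      · rw [← litTrue_congr (hστ _ (hE₀ e he).1), ← litTrue_congr (hστ _ (hE₀ e he).2.1)]
        exact h0 e he
      · obtain ⟨hlt, hj⟩ := hM i j hij
        rw [← litTrue_congr (hστ _ (hL i (hlt.trans hj)))] at hi
        rw [← litTrue_congr (hστ _ (by rw [entryLit_fst]; exact hL j hj))]
        let c : Fin t := ⟨j % t, Nat.mod_lt _ ht⟩
        have hjc : j / t * t + (c : ℕ) = j := Nat.div_add_mod' j t
        have hpat : blockPattern M t (j / t) i c = M i j := by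
          simp only [blockPattern, hjc]
        have hjq : j / t < m / t + 1 := Nat.lt_succ_of_le (Nat.div_le_div_right hj.le)
        obtain ⟨p, hp, hip⟩ := hQcov (j / t) hjq i
          (fun h => hij (by rw [← hpat, h]; rfl))
        have hpp : p ∈ pairs := by
          have := (hQ _ hp).1
          simp only [hpairs, Finset.mem_filter, Finset.mem_product, Finset.mem_range]
          exact ⟨⟨this.1, this.2.1⟩, this.2.2⟩
        have hZ : LitTrue σ (Z p) := by
          rcases hip with rfl | rfl
          · exact (h1 p hpp).1 hi
          · exact (h1 p hpp).2 hi
        have hW := h2 _ hp hZ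
        have := h3 ((j / t, blockPattern M t (j / t) i), c) (by
          simp only [hcells, Finset.mem_filter, Finset.mem_product, Finset.mem_range,
            Finset.mem_univ, and_true, hjc, hpat]
          exact ⟨hjq, hj, hij⟩) hW
        simpa only [hjc, hpat] using this
    · rintro ⟨h0, hΓ⟩
      let h : (ℕ × ℕ) ⊕ (ℕ × (Fin t → Fin 3)) → Prop :=
        Sum.elim (fun p => LitTrue τ (L p.1) ∨ LitTrue τ (L p.2))
          (fun w => ∃ x < m, blockPattern M t w.1 x = w.2 ∧ LitTrue τ (L x))
      let σ : ℕ → Bool := fun u => if u ∈ X then τ u else decide (∃ a, g a = u ∧ h a)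
      have hστ : ∀ x ∈ X, σ x = τ x := fun x hx => by simp [σ, hx]
      have hσ : ∀ a, LitTrue σ (g a, true) ↔ h a := by
        intro a
        simp only [LitTrue, σ, hgX, if_false, hg.eq_iff, exists_eq_left, decide_eq_true_eq]
      have hσL : ∀ i < m, (LitTrue σ (L i) ↔ LitTrue τ (L i)) :=
        fun i hi => litTrue_congr (hστ _ (hL i hi))
      refine ⟨σ, hστ, fun e he => ?_, fun p hp => ?_, fun e he hZ => ?_, fun c hc hW => ?_⟩
      · rw [litTrue_congr (hστ _ (hE₀ e he).1), litTrue_congr (hστ _ (hE₀ e he).2.1)]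
        exact h0 e he
      · simp only [hpairs, Finset.mem_filter, Finset.mem_product, Finset.mem_range] at hp
        rw [hσL _ hp.1.1, hσL _ hp.1.2, hσ]
        exact ⟨Or.inl, Or.inr⟩
      · obtain ⟨⟨ha, hb, -⟩, hpa, hpb⟩ := hQ e he
        rw [hσ]
        rcases (hσ _).1 hZ with h' | h'
        · exact ⟨_, ha, hpa, h'⟩
        · exact ⟨_, hb, hpb, h'⟩
      · obtain ⟨x, hx, hpat, hLx⟩ := (hσ _).1 hW
        simp only [hcells, Finset.mem_filter] at hc
        rw [litTrue_congr (hστ _ (by rw [entryLit_fst]; exact hL _ hc.2.1))]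
        have hval : M x (c.1.1 * t + c.2) = c.1.2 c.2 := congrFun hpat c.2
        rw [← hval]
        exact hΓ _ _ (by rw [hval]; exact hc.2.2) hLx
  · have hc := card_implFormula_le (E₀ ∪ E₁ ∪ E₂ ∪ E₃)
    have h3 := Finset.card_union_le (E₀ ∪ E₁ ∪ E₂) E₃
    have h2 := Finset.card_union_le (E₀ ∪ E₁) E₂
    have h1 := Finset.card_union_le E₀ E₁
    have hE₁ : E₁.card ≤ 2 * (m * (m / G + 1)) := by
      have hp : pairs.card ≤ _ := card_modEq_pairs_le m G
      have ha : (pairs.image (fun p => (L p.1, Z p))).card ≤ pairs.card := Finset.card_image_le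
      have hb : (pairs.image (fun p => (L p.2, Z p))).card ≤ pairs.card := Finset.card_image_le
      have := Finset.card_union_le (pairs.image (fun p => (L p.1, Z p)))
        (pairs.image (fun p => (L p.2, Z p)))
      change E₁.card ≤ _ at this
      omega
    have hE₂ : E₂.card ≤ Q.card := Finset.card_image_le
    have hE₃ : E₃.card ≤ (m / t + 1) * 3 ^ t * t := by
      refine Finset.card_image_le.trans ((Finset.card_filter_le _ _).trans ?_)
      simp
    omega

lemma exists_sorted_enumeration (V : Finset ℕ) (key : ℕ → ℕ) :
    ∃ v : ℕ → ℕ, (∀ i < V.card, v i ∈ V) ∧ (∀ x ∈ V, ∃ i < V.card, v i = x) ∧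
      ∀ i j, i ≤ j → j < V.card → key (v i) ≤ key (v j) := by
  let f : Fin V.card → ℕ := fun i => key (V.equivFin.symm i)
  let e : Fin V.card → ℕ := fun i => V.equivFin.symm (Tuple.sort f i)
  refine ⟨fun i => if h : i < V.card then e ⟨i, h⟩ else 0, fun i hi => ?_, fun x hx => ?_,
    fun i j hij hj => ?_⟩
  · simp [hi, e]
  · refine ⟨(Tuple.sort f).symm (V.equivFin ⟨x, hx⟩), Fin.is_lt _, ?_⟩
    simp [e]
  · have := Tuple.monotone_sort f (show (⟨i, hij.trans_lt hj⟩ : Fin V.card) ≤ ⟨j, hj⟩ from hij)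
    simpa [hj, hij.trans_lt hj, e, f] using this

lemma mem_vars {φ : Formula} {C : Clause} {l : Lit} (hC : C ∈ φ) (hl : l ∈ C) :
    l.1 ∈ Vars φ :=
  Finset.mem_biUnion.2 ⟨C, hC, Finset.mem_image_of_mem _ hl⟩

lemma exists_pair_of_is2CNF {φ : Formula} (hφ : Is2CNF φ) {C : Clause} (hC : C ∈ φ) {l : Lit}
    (hl : l ∈ C) : ∃ l', C = {l, l'} ∧ l.1 ≠ l'.1 := by
  obtain ⟨hcl, hcard⟩ := hφ C hC
  have : (C.erase l).card = 1 := by rw [Finset.card_erase_of_mem hl, hcard]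
  obtain ⟨l', hl'⟩ := Finset.card_eq_one.1 this
  have hCe : C = {l, l'} := by rw [← Finset.insert_erase hl, hl']
  refine ⟨l', hCe, fun h => ?_⟩
  have hne : l' ≠ l := Finset.ne_of_mem_erase (hl' ▸ Finset.mem_singleton_self l')
  have h2 : l'.2 = !l.2 := by
    by_contra h3
    exact hne (Prod.ext h.symm (by cases h4 : l.2 <;> cases h5 : l'.2 <;> simp_all))
  apply hcl l.1
  have ha : (l.1, l.2) ∈ C := hl
  have hb : (l.1, !l.2) ∈ C := by
    rw [← h2, h, hCe]; simp
  cases h4 : l.2 <;> simp_all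

/-- A satisfiable nonempty 2-CNF formula is equivalent to a linear number of implications
together with the implications prescribed by a strictly upper triangular ternary matrix. -/
lemma exists_matrix_form (φ : Formula) (hφ : Is2CNF φ) (hne : φ.Nonempty) (τ₀ : ℕ → Bool)
    (hτ₀ : Satisfies τ₀ φ) :
    ∃ (M : ℕ → ℕ → Fin 3) (L : ℕ → Lit) (E₀ : Finset (Lit × Lit)),
      (∀ i j, M i j ≠ 0 → i < j ∧ j < (Vars φ).card) ∧
      (∀ i < (Vars φ).card, (L i).1 ∈ Vars φ) ∧
      (∀ e ∈ E₀, e.1.1 ∈ Vars φ ∧ e.2.1 ∈ Vars φ ∧ e.1.1 ≠ e.2.1) ∧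
      E₀.card ≤ 4 * (Vars φ).card ∧
      ∀ τ, Satisfies τ φ ↔ (∀ e ∈ E₀, LitTrue τ e.1 → LitTrue τ e.2) ∧
        ∀ i j, M i j ≠ 0 → LitTrue τ (L i) → LitTrue τ (entryLit (M i j) (L j)) := by
  classical
  set V := Vars φ with hV
  let P : ℕ → Lit := fun x => (x, !τ₀ x)
  let Imp : ℕ → ℕ → Prop := fun x y =>
    ∀ τ, Satisfies τ φ → LitTrue τ (P x) → LitTrue τ (P y)
  let Exc : ℕ → ℕ → Prop := fun x y =>
    ∀ τ, Satisfies τ φ → LitTrue τ (P x) → ¬ LitTrue τ (P y)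
  let Forced : ℕ → Prop := fun x => ∀ τ, Satisfies τ φ → ¬ LitTrue τ (P x)
  have Imp_trans : ∀ {x y z}, Imp x y → Imp y z → Imp x z :=
    fun h h' τ hτ hx => h' τ hτ (h τ hτ hx)
  let key : ℕ → ℕ := fun x => (V.filter (fun z => Imp z x)).card
  obtain ⟨v, hvV, hvsurj, hvkey⟩ := exists_sorted_enumeration V key
  have key_imp : ∀ {x y}, y ∈ V → Imp x y → key y ≤ key x → Imp y x := by
    intro x y hy hxy hk
    have hsub : V.filter (fun z => Imp z x) ⊆ V.filter (fun z => Imp z y) :=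
      Finset.monotone_filter_right _ fun z _ h => Imp_trans h hxy
    have heq := Finset.eq_of_subset_of_card_le hsub hk
    have : y ∈ V.filter (fun z => Imp z y) :=
      Finset.mem_filter.2 ⟨hy, fun _ _ h => h⟩
    rw [← heq] at this
    exact (Finset.mem_filter.1 this).2
  let rep : ℕ → ℕ := fun x => sInf {y | y ∈ V ∧ Imp x y ∧ Imp y x}
  have rep_mem : ∀ x ∈ V, rep x ∈ V ∧ Imp x (rep x) ∧ Imp (rep x) x := fun x hx =>
    Nat.sInf_mem (s := {y | y ∈ V ∧ Imp x y ∧ Imp y x})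
      ⟨x, hx, fun _ _ h => h, fun _ _ h => h⟩
  have rep_eq : ∀ {x y}, Imp x y → Imp y x → rep x = rep y := by
    intro x y hxy hyx
    change sInf _ = sInf _
    congr 1
    ext z
    exact ⟨fun h => ⟨h.1, Imp_trans hyx h.2.1, Imp_trans h.2.2 hxy⟩,
      fun h => ⟨h.1, Imp_trans hxy h.2.1, Imp_trans h.2.2 hyx⟩⟩
  obtain ⟨a, b, ha, hb, hab⟩ : ∃ a b, a ∈ V ∧ b ∈ V ∧ a ≠ b := by
    obtain ⟨C, hC⟩ := hne
    obtain ⟨l, hl, -⟩ := hτ₀ C hC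
    obtain ⟨l', rfl, hll⟩ := exists_pair_of_is2CNF hφ hC hl
    exact ⟨l.1, l'.1, mem_vars hC hl, mem_vars hC (by simp), hll⟩
  let o : ℕ → ℕ := fun x => if x = a then b else a
  have hoV : ∀ x, o x ∈ V := fun x => by simp only [o]; split <;> assumption
  have hox : ∀ x, x ≠ o x := fun x => by simp only [o]; split <;> simp_all
  let M : ℕ → ℕ → Fin 3 := fun i j =>
    if i < j ∧ j < V.card then
      if Imp (v i) (v j) then 1 else if Exc (v i) (v j) then 2 else 0
    else 0
  let A := V.filter (fun x => x ≠ rep x)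
  let B := V.filter Forced
  let E₀ : Finset (Lit × Lit) :=
    (A.image (fun x => (P x, P (rep x))) ∪ A.image (fun x => (P (rep x), P x))) ∪
    (B.image (fun x => (P x, P (o x))) ∪ B.image (fun x => (P x, negLit (P (o x)))))
  refine ⟨M, fun i => P (v i), E₀, ?_, hvV, ?_, ?_, ?_⟩
  · intro i j h
    by_contra h'
    exact h (if_neg h')
  · simp only [E₀, Finset.forall_mem_union, Finset.forall_mem_image, A, B, Finset.mem_filter]
    exact ⟨⟨fun x hx => ⟨hx.1, (rep_mem x hx.1).1, hx.2⟩,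
      fun x hx => ⟨(rep_mem x hx.1).1, hx.1, hx.2.symm⟩⟩,
      fun x hx => ⟨hx.1, hoV x, hox x⟩, fun x hx => ⟨hx.1, hoV x, hox x⟩⟩
  · have hA : A.card ≤ V.card := Finset.card_filter_le _ _
    have hB : B.card ≤ V.card := Finset.card_filter_le _ _
    refine (Finset.card_union_le _ _).trans ((add_le_add (Finset.card_union_le _ _)
      (Finset.card_union_le _ _)).trans ?_)
    refine (add_le_add (add_le_add Finset.card_image_le Finset.card_image_le)
      (add_le_add Finset.card_image_le Finset.card_image_le)).trans ?_
    omega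
  · intro τ
    simp only [E₀, Finset.forall_mem_union, Finset.forall_mem_image, litTrue_negLit]
    constructor
    · intro hτ
      refine ⟨⟨⟨fun x hx => ?_, fun x hx => ?_⟩, fun x hx h => ?_, fun x hx h => ?_⟩,
        fun i j hij => ?_⟩
      · exact (rep_mem x (Finset.mem_filter.1 hx).1).2.1 τ hτ
      · exact (rep_mem x (Finset.mem_filter.1 hx).1).2.2 τ hτ
      · exact absurd h ((Finset.mem_filter.1 hx).2 τ hτ)
      · exact absurd h ((Finset.mem_filter.1 hx).2 τ hτ)
      · simp only [M, ne_eq] at hij ⊢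
        split_ifs at hij ⊢ with h1 h2 h3
        · simpa [entryLit] using h2 τ hτ
        · simpa [entryLit, litTrue_negLit] using h3 τ hτ
        all_goals exact absurd rfl hij
    · rintro ⟨⟨⟨hA1, hA2⟩, hB1, hB2⟩, hM⟩
      have hforced : ∀ x ∈ V, Forced x → ¬ LitTrue τ (P x) := fun x hx hf h =>
        hB2 (Finset.mem_filter.2 ⟨hx, hf⟩) h (hB1 (Finset.mem_filter.2 ⟨hx, hf⟩) h)
      have hrep : ∀ x ∈ V, (LitTrue τ (P x) ↔ LitTrue τ (P (rep x))) := by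
        intro x hx
        by_cases h : x = rep x
        · rw [← h]
        · have hxA : x ∈ A := Finset.mem_filter.2 ⟨hx, h⟩
          exact ⟨hA1 hxA, hA2 hxA⟩
      have hExc : ∀ i j, i < j → j < V.card → Exc (v i) (v j) →
          LitTrue τ (P (v i)) → ¬ LitTrue τ (P (v j)) := by
        intro i j hij hj hexc hi
        by_cases himp : Imp (v i) (v j)
        · exact absurd hi (hforced _ (hvV i (hij.trans hj))
            fun τ' hτ' h => hexc τ' hτ' h (himp τ' hτ' h))
        · have hMij : M i j = 2 := by simp [M, hij, hj, himp, hexc]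
          have := hM i j (by rw [hMij]; decide) hi
          simpa [hMij, entryLit, litTrue_negLit] using this
      intro C hC
      obtain ⟨l, hl, hlτ⟩ := hτ₀ C hC
      obtain ⟨l', rfl, hll⟩ := exists_pair_of_is2CNF hφ hC hl
      have hlV := mem_vars hC hl
      have hlV' := mem_vars hC (l := l') (by simp)
      have hlP : l = negLit (P l.1) := by
        simp only [LitTrue] at hlτ
        simp [negLit, P, hlτ]
      by_contra hcon
      simp only [Finset.mem_insert, Finset.mem_singleton, exists_eq_or_imp, exists_eq_left,
        not_or] at hcon
      obtain ⟨hc1, hc2⟩ := hcon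
      rw [hlP, litTrue_negLit, not_not] at hc1
      have hor : ∀ τ', Satisfies τ' φ → LitTrue τ' (P l.1) → LitTrue τ' l' := by
        intro τ' hτ' h
        have := hτ' _ hC
        simp only [Finset.mem_insert, Finset.mem_singleton, exists_eq_or_imp,
          exists_eq_left] at this
        rw [hlP, litTrue_negLit] at this
        exact this.resolve_left (not_not.2 h)
      obtain ⟨i, hi, hix⟩ := hvsurj _ hlV
      obtain ⟨j, hj, hjx⟩ := hvsurj _ hlV'
      have hij : i ≠ j := fun h => hll (by rw [← hix, ← hjx, h])
      by_cases hpos : l' = P l'.1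
      · rw [hpos] at hc2 hor
        have himp : Imp l.1 l'.1 := hor
        rcases lt_or_gt_of_ne hij with h | h
        · have hMij : M i j = 1 := by simp [M, h, hj, hix, hjx, himp]
          have := hM i j (by rw [hMij]; decide) (by rw [hix]; exact hc1)
          rw [hMij, hjx] at this
          exact hc2 (by simpa [entryLit] using this)
        · have himp' : Imp l'.1 l.1 :=
            key_imp hlV' himp (by simpa [hix, hjx] using hvkey j i h.le hi)
          rw [hrep _ hlV, rep_eq himp himp', ← hrep _ hlV'] at hc1
          exact hc2 hc1
      · have hneg : l' = negLit (P l'.1) := by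
          refine Prod.ext rfl ?_
          have : l'.2 ≠ !τ₀ l'.1 := fun h => hpos (Prod.ext rfl h)
          simp only [negLit, P]
          exact Bool.eq_not_of_ne this
        rw [hneg, litTrue_negLit, not_not] at hc2
        have hexc : Exc l.1 l'.1 := fun τ' hτ' h => by
          have := hor τ' hτ' h
          rwa [hneg, litTrue_negLit] at this
        have hexc' : Exc l'.1 l.1 := fun τ' hτ' h h' => hexc τ' hτ' h' h
        rcases lt_or_gt_of_ne hij with h | h
        · exact hExc i j h hj (by rwa [hix, hjx]) (by rwa [hix]) (by rwa [hjx])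
        · exact hExc j i h hi (by rwa [hix, hjx]) (by rwa [hjx]) (by rwa [hix])


/-- Four times the bound on the number of clauses obtained from blocks of width `t` merged in
groups of `G` rows, for `n` variables. -/
def encodingCost (n t G : ℕ) : ℕ :=
  4 * (4 * n) + 8 * (n * (n / G + 1)) +
    (t * ((n / t + 1) * (n / t + 1 + 1)) + 2 * ((n / t + 1) * (G * 3 ^ t))) +
    4 * ((n / t + 1) * 3 ^ t * t)

lemma encodingCost_mono {m n : ℕ} (h : m ≤ n) (t G : ℕ) :
    encodingCost m t G ≤ encodingCost n t G := by
  unfold encodingCost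
  gcongr

lemma encodingCost_sq_le {n t : ℕ} (ht : 0 < t) (h : t ^ 4 * 3 ^ t ≤ n) :
    (encodingCost n t (t ^ 2) : ℝ) ≤ (n : ℝ) ^ 2 / t * (1 + 49 / t) := by
  have hT : (1 : ℝ) ≤ t := by exact_mod_cast ht
  have hT0 : (0 : ℝ) < t := by linarith
  have hnR : (t : ℝ) ^ 4 * 3 ^ t ≤ n := by exact_mod_cast h
  have h3 : (1 : ℝ) ≤ 3 ^ t := one_le_pow₀ (by norm_num)
  have ht4 : (t : ℝ) ^ 4 ≤ n := (le_mul_of_one_le_right (by positivity) h3).trans hnR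
  have ht2 : (t : ℝ) ^ 2 ≤ n := (pow_le_pow_right₀ hT (by norm_num)).trans ht4
  have ht1 : (t : ℝ) ≤ n := (le_self_pow₀ hT (by norm_num)).trans ht4
  have hn0 : (0 : ℝ) < n := by linarith
  have hd : ((n / t : ℕ) : ℝ) ≤ n / t := Nat.cast_div_le
  have hd2 : ((n / t ^ 2 : ℕ) : ℝ) ≤ n / (t : ℝ) ^ 2 := by exact_mod_cast Nat.cast_div_le
  have hdn : (n : ℝ) / t ≤ n := div_le_self hn0.le hT
  set S : ℝ := (n : ℝ) ^ 2 / (t : ℝ) ^ 2 with hS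
  have hnS : (n : ℝ) ≤ S := by
    rw [hS, le_div_iff₀ (by positivity)]
    nlinarith
  have hd1 : (n : ℝ) / t + 1 ≤ 2 * n := by linarith
  have e1 : (n : ℝ) * (n / (t : ℝ) ^ 2 + 1) ≤ 2 * S := by
    have : (n : ℝ) * (n / (t : ℝ) ^ 2 + 1) = S + n := by rw [hS]; ring
    linarith
  have e2 : (t : ℝ) * ((n / t + 1) * (n / t + 1 + 1)) ≤ (n : ℝ) ^ 2 / t + 5 * S := by
    have : (t : ℝ) * ((n / t + 1) * (n / t + 1 + 1)) = (n : ℝ) ^ 2 / t + 3 * n + 2 * t := by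
      field_simp; ring
    linarith
  have e3 : (n / t + 1) * ((t : ℝ) ^ 2 * 3 ^ t) ≤ 2 * S := by
    have : (t : ℝ) ^ 2 * 3 ^ t ≤ n / (t : ℝ) ^ 2 := by
      rw [le_div_iff₀ (by positivity)]
      calc _ = (t : ℝ) ^ 4 * 3 ^ t := by ring
        _ ≤ n := hnR
    calc _ ≤ (2 * n) * (n / (t : ℝ) ^ 2) := by gcongr
      _ = 2 * S := by rw [hS]; ring
  have e4 : (n / t + 1) * 3 ^ t * (t : ℝ) ≤ 2 * S := by
    refine le_trans ?_ e3
    rw [mul_assoc, mul_comm (3 ^ t : ℝ)]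
    gcongr
    exact le_self_pow₀ hT (by norm_num)
  have hfin : (n : ℝ) ^ 2 / t * (1 + 49 / t) = (n : ℝ) ^ 2 / t + 49 * S := by
    rw [hS]; field_simp
  rw [hfin]
  calc (encodingCost n t (t ^ 2) : ℝ)
      = 4 * (4 * (n : ℝ)) + 8 * (n * ((n / t ^ 2 : ℕ) + 1)) +
        (t * (((n / t : ℕ) + 1) * ((n / t : ℕ) + 1 + 1)) +
          2 * (((n / t : ℕ) + 1) * ((t : ℝ) ^ 2 * 3 ^ t))) +
        4 * (((n / t : ℕ) + 1) * 3 ^ t * t) := by unfold encodingCost; push_cast; ring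
    _ ≤ 4 * (4 * (n : ℝ)) + 8 * (n * (n / (t : ℝ) ^ 2 + 1)) +
        (t * ((n / t + 1) * (n / t + 1 + 1)) + 2 * ((n / t + 1) * ((t : ℝ) ^ 2 * 3 ^ t))) +
        4 * ((n / t + 1) * 3 ^ t * t) := by gcongr
    _ ≤ _ := by linarith

open Filter Topology in
lemma exists_block_width (ε : ℝ) (hε : 0 < ε) :
    ∀ᶠ n : ℕ in atTop, ∃ t : ℕ, 0 < t ∧ t ^ 4 * 3 ^ t ≤ n ∧
      (1 + 49 / (t : ℝ)) / t ≤ 4 * (Real.logb 2 3 / 4 + ε) / Real.logb 2 n := by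
  have hl2 : 0 < Real.log 2 := Real.log_pos (by norm_num)
  have hl3 : 0 < Real.log 3 := Real.log_pos (by norm_num)
  set k : ℝ := Real.log 3 + 2 * ε * Real.log 2 with hk
  have hkε : 0 < ε * Real.log 2 := by positivity
  have hk0 : 0 < k := by rw [hk]; linarith
  have hδ : 0 < 1 - Real.log 3 / k := by
    rw [sub_pos, div_lt_one hk0, hk]; linarith
  have hfl : Tendsto (fun x : ℝ => (⌊k⁻¹ * x⌋₊ : ℝ)) atTop atTop :=
    tendsto_natCast_atTop_atTop.comp
      (tendsto_nat_floor_atTop.comp (tendsto_id.const_mul_atTop (inv_pos.2 hk0)))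
  have hlim : Tendsto (fun x : ℝ => (1 + 49 / (⌊k⁻¹ * x⌋₊ : ℝ)) * ((⌊k⁻¹ * x⌋₊ : ℝ) / x)⁻¹)
      atTop (𝓝 ((1 + 0) * (k⁻¹)⁻¹)) :=
    (tendsto_const_nhds.add (tendsto_const_nhds.div_atTop hfl)).mul
      ((tendsto_nat_floor_mul_div_atTop (inv_pos.2 hk0).le).inv₀ (inv_pos.2 hk0).ne')
  have hev1 := hlim.eventually_lt_const
    (show (1 + 0) * (k⁻¹)⁻¹ < Real.log 3 + 4 * ε * Real.log 2 by
      rw [inv_inv, add_zero, one_mul, hk]; linarith)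
  have hev2 := (isLittleO_pow_exp_pos_mul_atTop 4 hδ).bound (show 0 < k ^ 4 by positivity)
  have hlog : Tendsto (fun n : ℕ => Real.log n) atTop atTop :=
    Real.tendsto_log_atTop.comp tendsto_natCast_atTop_atTop
  filter_upwards [hlog.eventually hev1, hlog.eventually hev2,
    hlog.eventually (hfl.eventually_gt_atTop 0), hlog.eventually_gt_atTop 0,
    eventually_gt_atTop 0] with n h1 h2 h3 h4 hn
  set t := ⌊k⁻¹ * Real.log n⌋₊
  have ht : (t : ℝ) ≤ k⁻¹ * Real.log n := Nat.floor_le (by positivity)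
  refine ⟨t, by exact_mod_cast h3, ?_, ?_⟩
  · have hn' : (0 : ℝ) < n := by exact_mod_cast hn
    have e1 : (3 : ℝ) ^ t ≤ Real.exp (Real.log 3 / k * Real.log n) := by
      rw [← Real.rpow_natCast, Real.rpow_def_of_pos (by norm_num)]
      apply Real.exp_le_exp.2
      calc Real.log 3 * t ≤ Real.log 3 * (k⁻¹ * Real.log n) := by gcongr
        _ = _ := by ring
    have e2 : (t : ℝ) ^ 4 ≤ Real.exp ((1 - Real.log 3 / k) * Real.log n) := by
      rw [Real.norm_of_nonneg (by positivity), Real.norm_of_nonneg (by positivity)] at h2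
      calc (t : ℝ) ^ 4 ≤ (k⁻¹ * Real.log n) ^ 4 := by gcongr
        _ = (k ^ 4)⁻¹ * Real.log n ^ 4 := by rw [mul_pow, inv_pow]
        _ ≤ _ := by rwa [inv_mul_le_iff₀ (by positivity)]
    have : (t : ℝ) ^ 4 * 3 ^ t ≤ n :=
      calc _ ≤ Real.exp ((1 - Real.log 3 / k) * Real.log n) *
            Real.exp (Real.log 3 / k * Real.log n) := by gcongr
        _ = n := by
          rw [← Real.exp_add, ← add_mul, sub_add_cancel, one_mul, Real.exp_log hn']
    exact_mod_cast this
  · rw [inv_div] at h1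
    have hR : 4 * (Real.logb 2 3 / 4 + ε) / Real.logb 2 n =
        (Real.log 3 + 4 * ε * Real.log 2) / Real.log n := by
      rw [Real.logb, Real.logb]; field_simp
    rw [hR, le_div_iff₀ h4]
    calc _ = (1 + 49 / (t : ℝ)) * (Real.log n / t) := by ring
      _ ≤ _ := h1.le

/-- The unsatisfiable formula consisting of all clauses over the variables `0` and `1`. -/
def contradiction : Formula :=
  {{(0, true), (1, true)}, {(0, true), (1, false)}, {(0, false), (1, true)},
    {(0, false), (1, false)}}

lemma is2CNF_contradiction : Is2CNF contradiction := by
  simp only [Is2CNF, contradiction, Finset.forall_mem_insert, Finset.mem_singleton, forall_eq,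
    IsClause]
  refine ⟨⟨?_, rfl⟩, ⟨?_, rfl⟩, ⟨?_, rfl⟩, ?_, rfl⟩ <;> intro v <;> simp <;> omega

lemma not_satisfies_contradiction (τ : ℕ → Bool) : ¬ Satisfies τ contradiction := by
  intro h
  have hmem : ({(0, !τ 0), (1, !τ 1)} : Clause) ∈ contradiction := by
    cases τ 0 <;> cases τ 1 <;> decide
  simpa [LitTrue] using h _ hmem

lemma exists_encoding_card_le (φ : Formula) (hφ : Is2CNF φ) {n t G : ℕ} (hn : 0 < n)
    (hcard : (Vars φ).card ≤ n) (ht : 0 < t) (hG : 0 < G) :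
    ∃ φ' : Formula, Is2CNF φ' ∧ Encodes φ' φ (Vars φ) ∧ 4 * φ'.card ≤ encodingCost n t G := by
  by_cases hsat : ∃ τ₀, Satisfies τ₀ φ
  · obtain ⟨τ₀, hτ₀⟩ := hsat
    rcases φ.eq_empty_or_nonempty with rfl | hne
    · exact ⟨∅, hφ, fun τ => ⟨fun h => ⟨τ, fun _ _ => rfl, h⟩, fun _ => by simp [Satisfies]⟩, by simp⟩
    obtain ⟨M, L, E₀, hM, hL, hE₀, hE₀card, hsem⟩ := exists_matrix_form φ hφ hne τ₀ hτ₀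
    obtain ⟨φ', h2, henc, hle⟩ :=
      exists_matrix_encoding _ t G ht hG M hM (Vars φ) L hL E₀ hE₀
    refine ⟨φ', h2, fun τ => (hsem τ).trans (henc τ).symm,
      le_trans ?_ (encodingCost_mono hcard t G)⟩
    unfold encodingCost
    omega
  · refine ⟨contradiction, is2CNF_contradiction, fun τ => ⟨fun h => absurd ⟨τ, h⟩ hsat, ?_⟩, ?_⟩
    · rintro ⟨σ, -, h⟩
      exact absurd h (not_satisfies_contradiction σ)
    · have : contradiction.card ≤ 4 := Finset.card_le_four
      unfold encodingCost
      omega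

/-- every 2-CNF formula has a small 2-CNF encoding. -/
theorem encoding_upper (ε : ℝ) (hε : 0 < ε) :
    ∃ N : ℕ, ∀ n : ℕ, N ≤ n → ∀ φ : Formula, Is2CNF φ → (Vars φ).card ≤ n →
      ∃ φ' : Formula, Is2CNF φ' ∧ Encodes φ' φ (Vars φ) ∧
        (φ'.card : ℝ) ≤ (Real.logb 2 3 / 4 + ε) * (n : ℝ) ^ 2 / Real.logb 2 (n : ℝ) := by
  obtain ⟨N, hN⟩ := Filter.eventually_atTop.1 (exists_block_width ε hε)
  refine ⟨N, fun n hn φ hφ hcard => ?_⟩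
  obtain ⟨t, ht, htn, hbound⟩ := hN n hn
  have hn0 : 0 < n := lt_of_lt_of_le (by positivity) htn
  obtain ⟨φ', h2, henc, hle⟩ :=
    exists_encoding_card_le φ hφ hn0 hcard ht (pow_pos ht 2)
  refine ⟨φ', h2, henc, ?_⟩
  have hle' : 4 * (φ'.card : ℝ) ≤ encodingCost n t (t ^ 2) := by exact_mod_cast hle
  have hcost := encodingCost_sq_le ht htn
  have hmul := mul_le_mul_of_nonneg_left hbound (sq_nonneg (n : ℝ))
  have e1 : (n : ℝ) ^ 2 / t * (1 + 49 / t) = (n : ℝ) ^ 2 * ((1 + 49 / (t : ℝ)) / t) := by ring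
  have e2 : (n : ℝ) ^ 2 * (4 * (Real.logb 2 3 / 4 + ε) / Real.logb 2 n) =
      4 * ((Real.logb 2 3 / 4 + ε) * (n : ℝ) ^ 2 / Real.logb 2 n) := by ring
  linarith

end BVAPaper
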